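/- Let Q be a poset and U, U′ ⊆ Q upsets. Then Hom_Q(k[U′], k[U]) is isomorphic to k^{{S ∈ π_0(U′) : S ⊆ U}}, the space of k-valued functions on the set of connected components of U′ that are contained in U. Explicitly: every homomorphism k[U′] → k[U] acts by a single scalar in all degrees of each connected component of U′ contained in U and is zero in degrees of components of U′ not contained in U, and every such choice of scalars arises from a unique homomorphism. -/

import Mathlib

/-- The component of the indicator module `k[S]` in degree `q`: the field `k`
(as the full submodule of itself) if `q ∈ S`, and `0` otherwise. -/
noncomputable def cmpt (k : Type) [Field k] {Q : Type} (S : Set Q) (q : Q) : Submodule k k :=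
  haveI := Classical.dec (q ∈ S)
  if q ∈ S then ⊤ else ⊥

/-- The structure map of the indicator module `k[S]` for `q ≤ q'`:
the identity of `k` when `q, q' ∈ S`, and `0` otherwise. -/
noncomputable def stMap (k : Type) [Field k] {Q : Type} [PartialOrder Q] (S : Set Q)
    {q q' : Q} (h : q ≤ q') : ↥(cmpt k S q) →ₗ[k] ↥(cmpt k S q') :=
  haveI := Classical.dec (q ∈ S ∧ q' ∈ S)
  if hq : q ∈ S ∧ q' ∈ S then
    Submodule.inclusion (by simp [cmpt, hq.1, hq.2])
  else 0

/-- The space of `Q`-module homomorphisms `k[S] → k[T]` between indicator modules: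
families of linear maps in each degree commuting with the structure maps. -/
noncomputable def HomQ (k : Type) [Field k] {Q : Type} [PartialOrder Q] (S T : Set Q) :
    Submodule k (∀ q : Q, ↥(cmpt k S q) →ₗ[k] ↥(cmpt k T q)) where
  carrier := {φ | ∀ (q q' : Q) (h : q ≤ q'), stMap k T h ∘ₗ φ q = φ q' ∘ₗ stMap k S h}
  add_mem' := by
    intro a b ha hb
    simp only [Set.mem_setOf_eq] at ha hb ⊢
    intro q q' h
    ext x
    have ha' := congrArg (fun g => g x) (ha q q' h)
    have hb' := congrArg (fun g => g x) (hb q q' h)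
    simp only [LinearMap.comp_apply] at ha' hb' ⊢
    simp only [Pi.add_apply, LinearMap.add_apply, map_add, ha', hb']
  zero_mem' := by
    simp only [Set.mem_setOf_eq]
    intro q q' h
    ext x
    simp
  smul_mem' := by
    intro c a ha
    simp only [Set.mem_setOf_eq] at ha ⊢
    intro q q' h
    ext x
    have ha' := congrArg (fun g => g x) (ha q q' h)
    simp only [LinearMap.comp_apply] at ha' ⊢
    simp only [Pi.smul_apply, LinearMap.smul_apply, map_smul, ha']

/-- The scalar by which a homomorphism of indicator modules acts in degree `q`. -/
noncomputable def scl {k : Type} [Field k] {Q : Type} {S T : Set Q}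
    (φ : ∀ q : Q, ↥(cmpt k S q) →ₗ[k] ↥(cmpt k T q)) (q : Q) (hq : q ∈ S) : k :=
  (φ q ⟨1, by simp [cmpt, hq]⟩ : ↥(cmpt k T q)).1

/-- The set of connected components of a subset `S` of a poset: the quotient of `S`
by the equivalence relation generated by comparability (zigzag paths within `S`). -/
def Pi0 {Q : Type} [PartialOrder Q] (S : Set Q) : Type :=
  Quot (fun a b : S => (a : Q) ≤ (b : Q))

/-- The connected component `c` of `S` is contained in the subset `T`. -/
def compSub {Q : Type} [PartialOrder Q] (S T : Set Q) (c : Pi0 S) : Prop :=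
  ∀ a : S, Quot.mk _ a = c → (a : Q) ∈ T

section IndicatorModules

variable {k : Type} [Field k] {Q : Type}

theorem mem_cmpt {S : Set Q} {q : Q} {x : k} : x ∈ cmpt k S q ↔ q ∈ S ∨ x = 0 := by
  unfold cmpt
  by_cases h : q ∈ S <;> simp [h]

theorem coe_eq_zero_of_notMem {S : Set Q} {q : Q} (hq : q ∉ S) (x : cmpt k S q) : (x : k) = 0 :=
  (mem_cmpt.1 x.2).resolve_left hq

theorem coe_apply_eq_scl_mul {S T : Set Q} (φ : ∀ q : Q, ↥(cmpt k S q) →ₗ[k] ↥(cmpt k T q))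
    (q : Q) (hq : q ∈ S) (x : cmpt k S q) : (φ q x : k) = scl φ q hq * x := by
  have hx : x = (x : k) • (⟨1, mem_cmpt.2 (Or.inl hq)⟩ : cmpt k S q) := by
    ext; simp
  conv_lhs => rw [hx, map_smul]
  simp [scl, mul_comm]

variable [PartialOrder Q]

theorem coe_stMap {S : Set Q} (hS : IsUpperSet S) {q q' : Q} (h : q ≤ q') (x : cmpt k S q) :
    (stMap k S h x : k) = x := by
  unfold stMap
  by_cases hq : q ∈ S
  · simp [hq, hS h hq]
  · simp [hq, coe_eq_zero_of_notMem hq x]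

theorem scl_eq_of_le {S T : Set Q} (hS : IsUpperSet S) (hT : IsUpperSet T) (φ : HomQ k S T)
    {q q' : Q} (hq : q ∈ S) (hq' : q' ∈ S) (h : q ≤ q') : scl φ.1 q hq = scl φ.1 q' hq' := by
  have key := congrArg (fun y : cmpt k T q' => (y : k))
    (LinearMap.congr_fun (φ.2 q q' h) ⟨1, mem_cmpt.2 (Or.inl hq)⟩)
  simp only [LinearMap.comp_apply, coe_stMap hT, coe_apply_eq_scl_mul φ.1 q' hq',
    coe_stMap hS, mul_one] at key
  exact key

/-- The scalar by which a homomorphism acts on a connected component. -/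
noncomputable def compScl {S T : Set Q} (hS : IsUpperSet S) (hT : IsUpperSet T)
    (φ : HomQ k S T) : Pi0 S → k :=
  Quot.lift (fun a => scl φ.1 a.1 a.2) fun a b h => scl_eq_of_le hS hT φ a.2 b.2 h

theorem compScl_eq_zero {S T : Set Q} (hS : IsUpperSet S) (hT : IsUpperSet T)
    (φ : HomQ k S T) {c : Pi0 S} (hc : ¬ compSub S T c) : compScl hS hT φ c = 0 := by
  unfold compSub at hc
  push Not at hc
  obtain ⟨a, rfl, ha⟩ := hc
  exact coe_eq_zero_of_notMem ha _

/-- Restriction of the component scalars to the components of `S` contained in `T`. -/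
noncomputable def compSclLinearMap {S T : Set Q} (hS : IsUpperSet S) (hT : IsUpperSet T) :
    HomQ k S T →ₗ[k] ({c : Pi0 S // compSub S T c} → k) where
  toFun φ c := compScl hS hT φ c
  map_add' φ ψ := by
    ext ⟨⟨a⟩, hc⟩
    rfl
  map_smul' r φ := by
    ext ⟨⟨a⟩, hc⟩
    rfl

theorem compSclLinearMap_injective {S T : Set Q} (hS : IsUpperSet S) (hT : IsUpperSet T) :
    Function.Injective (compSclLinearMap (k := k) hS hT) := by
  intro φ ψ h
  ext q x
  by_cases hq : q ∈ S
  · rw [coe_apply_eq_scl_mul φ.1 q hq, coe_apply_eq_scl_mul ψ.1 q hq]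
    congr 1
    change compScl hS hT φ (Quot.mk _ ⟨q, hq⟩) = compScl hS hT ψ (Quot.mk _ ⟨q, hq⟩)
    by_cases hc : compSub S T (Quot.mk _ ⟨q, hq⟩)
    · exact congrFun h ⟨_, hc⟩
    · rw [compScl_eq_zero hS hT φ hc, compScl_eq_zero hS hT ψ hc]
  · have hx : x = 0 := Subtype.ext (coe_eq_zero_of_notMem hq x)
    simp [hx]

open Classical in
/-- The scalar in degree `q` of the homomorphism with prescribed component scalars `f`. -/
noncomputable def degreeScl {S T : Set Q} (f : {c : Pi0 S // compSub S T c} → k) (q : Q) : k :=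
  if hq : q ∈ S then Function.extend Subtype.val f 0 (Quot.mk _ ⟨q, hq⟩) else 0

theorem degreeScl_eq_of_le {S T : Set Q} (f : {c : Pi0 S // compSub S T c} → k)
    {q q' : Q} (hq : q ∈ S) (hq' : q' ∈ S) (h : q ≤ q') : degreeScl f q = degreeScl f q' := by
  have hc : (Quot.mk _ ⟨q, hq⟩ : Pi0 S) = Quot.mk _ ⟨q', hq'⟩ := Quot.sound h
  rw [degreeScl, degreeScl, dif_pos hq, dif_pos hq', hc]

theorem degreeScl_mul_mem {S T : Set Q} (f : {c : Pi0 S // compSub S T c} → k) (q : Q) (x : k) :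
    degreeScl f q * x ∈ cmpt k T q := by
  unfold degreeScl
  split_ifs with hq
  · by_cases hc : compSub S T (Quot.mk _ ⟨q, hq⟩)
    · exact mem_cmpt.2 (Or.inl (hc ⟨q, hq⟩ rfl))
    · exact mem_cmpt.2 <| Or.inr <| mul_eq_zero_of_left
        (Function.extend_apply' (f := Subtype.val) f 0 (Quot.mk _ ⟨q, hq⟩ : Pi0 S)
          fun ⟨c, h⟩ => hc (h ▸ c.2)) x
  · simp

/-- The homomorphism with prescribed component scalars. -/
noncomputable def homOfScl {S T : Set Q} (hS : IsUpperSet S) (hT : IsUpperSet T)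
    (f : {c : Pi0 S // compSub S T c} → k) : HomQ k S T :=
  ⟨fun q => (LinearMap.mulLeft k (degreeScl f q)).restrict
      fun x _ => degreeScl_mul_mem f q x, by
    intro q q' h
    ext x
    rw [LinearMap.comp_apply, coe_stMap hT]
    change degreeScl f q * (x : k) = degreeScl f q' * (stMap k S h x : k)
    rw [coe_stMap hS]
    by_cases hq : q ∈ S
    · rw [degreeScl_eq_of_le f hq (hS h hq) h]
    · rw [coe_eq_zero_of_notMem hq x, mul_zero, mul_zero]⟩

theorem compSclLinearMap_surjective {S T : Set Q} (hS : IsUpperSet S) (hT : IsUpperSet T) :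
    Function.Surjective (compSclLinearMap (k := k) hS hT) := by
  intro f
  refine ⟨homOfScl hS hT f, ?_⟩
  ext ⟨⟨a⟩, hc⟩
  change degreeScl f a * 1 = _
  rw [mul_one, degreeScl, dif_pos a.2]
  exact Subtype.val_injective.extend_apply f 0 ⟨Quot.mk _ a, hc⟩

end IndicatorModules

/-- For upsets `U', U` in a poset `Q`, the space `Hom_Q(k[U'], k[U])` is
isomorphic to the space of `k`-valued functions on the set of connected components of `U'`
contained in `U`; explicitly, every homomorphism acts by a single scalar on each component
of `U'` contained in `U` and by zero on the components not contained in `U`, and every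
such choice of scalars arises from a unique homomorphism. -/
theorem hom_upset_module_upset_module (k : Type) [Field k] (Q : Type) [PartialOrder Q]
    (U' U : Set Q) (hU' : IsUpperSet U') (hU : IsUpperSet U) :
    ∃ e : ↥(HomQ k U' U) ≃ₗ[k] ({c : Pi0 U' // compSub U' U c} → k),
      (∀ (φ : ↥(HomQ k U' U)) (q : Q) (hq : q ∈ U')
          (hc : compSub U' U (Quot.mk _ ⟨q, hq⟩)),
        scl φ.1 q hq = e φ ⟨Quot.mk _ ⟨q, hq⟩, hc⟩) ∧
      (∀ (φ : ↥(HomQ k U' U)) (q : Q) (hq : q ∈ U'),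
        ¬ compSub U' U (Quot.mk _ ⟨q, hq⟩) → φ.1 q = 0) := by
  refine ⟨LinearEquiv.ofBijective (compSclLinearMap hU' hU)
    ⟨compSclLinearMap_injective hU' hU, compSclLinearMap_surjective hU' hU⟩,
    fun φ q hq hc => rfl, fun φ q hq hc => ?_⟩
  ext x
  have h0 : scl φ.1 q hq = 0 := compScl_eq_zero hU' hU φ hc
  simp [coe_apply_eq_scl_mul φ.1 q hq, h0]
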